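/- arXiv:1402.4583 — 3 statements merged into one kernel-verified Lean document; each statement's English description precedes it below -/
import Mathlib

section
/- Let u be a rational number with u ∉ {−2, −1, −1/2, 0, 1}. Then the diagonal quartic surface (1+u)X⁴ + 4u²(1+u)Y⁴ − uZ⁴ − W⁴ = 0 has infinitely many rational points; that is, there exist infinitely many pairwise non-proportional quadruples (X, Y, Z, W) ∈ ℚ⁴ \ {(0,0,0,0)} satisfying the equation. -/
/-- The point `(x, d * x)` lies on the elliptic curve
`y² = x (x² - 2 u x + u (u + 2) (2 u + 1))`, and `x ≠ 0`. -/
def OnCurve (u x d : ℚ) : Prop :=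
  x ≠ 0 ∧ x * d ^ 2 = x ^ 2 - 2 * u * x + u * (u + 2) * (2 * u + 1)

theorem padicNorm_two_two : padicNorm 2 2 = 1 / 2 := by
  have h := padicNorm.padicNorm_p_of_prime (p := 2)
  norm_num at h ⊢
  exact h

theorem padicNorm_add_eq_right {a b : ℚ} (h : padicNorm 2 a < padicNorm 2 b) :
    padicNorm 2 (a + b) = padicNorm 2 b := by
  rw [padicNorm.add_eq_max_of_ne h.ne, max_eq_right h.le]

/-- The ring of `2`-adically integral rational numbers. -/
def twoIntegral : Subring ℚ where
  carrier := {q | padicNorm 2 q ≤ 1}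
  mul_mem' := by
    intro a b ha hb
    simp only [Set.mem_ofPred_eq] at *
    rw [padicNorm.mul]
    exact mul_le_one₀ ha (padicNorm.nonneg _) hb
  one_mem' := by simp
  add_mem' := fun ha hb => padicNorm.nonarchimedean.trans (max_le ha hb)
  zero_mem' := by simp
  neg_mem' := by
    intro a ha
    simpa using ha

theorem padicNorm_two_mul_lt_one {k : ℚ} (hk : k ∈ twoIntegral) : padicNorm 2 (2 * k) < 1 := by
  have : padicNorm 2 k ≤ 1 := hk
  rw [padicNorm.mul, padicNorm_two_two]
  linarith

theorem padicNorm_two_mul_add_one {k : ℚ} (hk : k ∈ twoIntegral) :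
    padicNorm 2 (2 * k + 1) = 1 := by
  rw [padicNorm_add_eq_right] <;> rw [padicNorm.one]
  exact padicNorm_two_mul_lt_one hk

/-- A rational number that is not a `2`-adic unit but is `2`-adically integral is twice a
`2`-adically integral number. -/
theorem exists_eq_two_mul {q : ℚ} (h : padicNorm 2 q < 1) :
    ∃ k ∈ twoIntegral, q = 2 * k := by
  refine ⟨q / 2, ?_, by ring⟩
  change padicNorm 2 (q / 2) ≤ 1
  rcases eq_or_ne q 0 with rfl | hq
  · simp
  obtain ⟨z, hz⟩ := padicNorm.values_discrete (p := 2) hq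
  rw [padicNorm.div, padicNorm_two_two, hz]
  rw [hz] at h
  have hz' : (1 : ℤ) ≤ z := by
    by_contra! hlt
    have : (1 : ℚ) ≤ (2 : ℚ) ^ (-z) := one_le_zpow₀ (by norm_num) (by omega)
    push_cast at h
    linarith
  have : (2 : ℚ) ^ (-z) ≤ (2 : ℚ) ^ (-1 : ℤ) := zpow_le_zpow_right₀ (by norm_num) (by omega)
  push_cast
  norm_num at this ⊢
  linarith

/-- A `2`-adic unit in `ℚ` is congruent to `1` modulo `2`. -/
theorem exists_eq_two_mul_add_one {q : ℚ} (h : padicNorm 2 q = 1) :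
    ∃ k ∈ twoIntegral, q = 2 * k + 1 := by
  suffices hlt : padicNorm 2 (q - 1) < 1 by
    obtain ⟨k, hk, e⟩ := exists_eq_two_mul hlt
    exact ⟨k, hk, by linarith⟩
  have hmul : padicNorm 2 (q.num : ℚ) = padicNorm 2 (q.den : ℚ) := by
    have := congrArg (padicNorm 2) (Rat.mul_den_eq_num q)
    rw [padicNorm.mul, h, one_mul] at this
    exact this.symm
  have hden : padicNorm 2 (q.den : ℚ) = 1 := by
    by_contra hne
    have hlt : padicNorm 2 (q.den : ℚ) < 1 := lt_of_le_of_ne (padicNorm.of_nat _) hne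
    have hd := (padicNorm.nat_lt_one_iff (p := 2) q.den).1 hlt
    have hn := (padicNorm.int_lt_one_iff (p := 2) q.num).1 (hmul ▸ hlt)
    have := Nat.dvd_gcd (Int.natCast_dvd.1 hn) hd
    rw [q.reduced] at this
    omega
  have key : (q - 1) * q.den = ((q.num - q.den : ℤ) : ℚ) := by
    push_cast
    rw [sub_mul, Rat.mul_den_eq_num, one_mul]
  have := congrArg (padicNorm 2) key
  rw [padicNorm.mul, hden, mul_one] at this
  rw [this, padicNorm.int_lt_one_iff]
  have hd : ¬ 2 ∣ q.den := (padicNorm.nat_eq_one_iff (p := 2) q.den).1 hden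
  have hn : ¬ ((2 : ℕ) : ℤ) ∣ q.num :=
    (padicNorm.int_eq_one_iff (p := 2) q.num).1 (hmul.trans hden)
  push_cast at hn ⊢
  omega

/-- The duplication formula. -/
theorem OnCurve.double {u x d s : ℚ} (h : OnCurve u x d)
    (hs : x * s = x ^ 2 - u * (u + 2) * (2 * u + 1)) (hs0 : s ≠ 0) (hd : d ≠ 0) :
    OnCurve u ((s / (2 * d)) ^ 2) ((d ^ 4 + 8 * u * (1 + u) ^ 2) / (2 * d * s)) := by
  obtain ⟨hx, h⟩ := h
  refine ⟨by positivity, ?_⟩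
  have hsq : s ^ 2 = d ^ 4 + 4 * u * d ^ 2 - 8 * u * (1 + u) ^ 2 := by
    have hd2 : d ^ 2 = (x ^ 2 - 2 * u * x + u * (u + 2) * (2 * u + 1)) / x := by
      field_simp; linarith
    have hs' : s = (x ^ 2 - u * (u + 2) * (2 * u + 1)) / x := by
      field_simp; linarith
    rw [show d ^ 4 = (d ^ 2) ^ 2 by ring, hd2, hs']
    field_simp
    ring
  field_simp
  rw [hsq]
  ring

theorem padicNorm_sq_div (s d : ℚ) :
    padicNorm 2 ((s / (2 * d)) ^ 2) = 4 * padicNorm 2 s ^ 2 / padicNorm 2 d ^ 2 := by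
  rw [pow_two, padicNorm.mul, padicNorm.div, padicNorm.mul, padicNorm_two_two]
  field_simp
  norm_num

theorem constantTerm_mem {u : ℚ} (hu : u ∈ twoIntegral) :
    u * (u + 2) * (2 * u + 1) ∈ twoIntegral := by
  let v : twoIntegral := ⟨u, hu⟩
  exact (v * (v + 2) * (2 * v + 1)).2

/-- Duplication increases the `2`-adic size of a point that is not `2`-adically integral. -/
theorem OnCurve.exists_double_of_one_lt {u x d : ℚ} (hu : u ∈ twoIntegral) (h : OnCurve u x d)
    (hx : 1 < padicNorm 2 x) :
    ∃ x' d', OnCurve u x' d' ∧ padicNorm 2 x < padicNorm 2 x' := by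
  have hb : padicNorm 2 (u * (u + 2) * (2 * u + 1)) ≤ 1 := constantTerm_mem hu
  have hxx : padicNorm 2 (x ^ 2) = padicNorm 2 x ^ 2 := by rw [pow_two, padicNorm.mul, pow_two]
  obtain ⟨s, hs⟩ : ∃ s, x * s = x ^ 2 - u * (u + 2) * (2 * u + 1) :=
    ⟨(x ^ 2 - u * (u + 2) * (2 * u + 1)) / x, mul_div_cancel₀ _ h.1⟩
  have hns : padicNorm 2 s = padicNorm 2 x := by
    have := congrArg (padicNorm 2) hs
    rw [sub_eq_neg_add, padicNorm_add_eq_right, padicNorm.mul, hxx] at this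
    · nlinarith
    · rw [padicNorm.neg, hxx]; nlinarith
  have hnd : padicNorm 2 d ^ 2 = padicNorm 2 x := by
    have := congrArg (padicNorm 2) h.2
    rw [show x ^ 2 - 2 * u * x + u * (u + 2) * (2 * u + 1)
        = (2 * (-u) * x + u * (u + 2) * (2 * u + 1)) + x ^ 2 by ring,
      padicNorm_add_eq_right, padicNorm.mul, hxx, pow_two d, padicNorm.mul] at this
    · nlinarith
    · rw [hxx]
      refine padicNorm.nonarchimedean.trans_lt (max_lt ?_ (by nlinarith))
      rw [padicNorm.mul]
      have := padicNorm_two_mul_lt_one (twoIntegral.neg_mem hu)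
      nlinarith
  have hs0 : s ≠ 0 := by
    rintro rfl
    rw [padicNorm.zero] at hns
    linarith
  have hd0 : d ≠ 0 := by
    rintro rfl
    rw [padicNorm.zero] at hnd
    linarith
  refine ⟨_, _, h.double hs hs0 hd0, ?_⟩
  rw [padicNorm_sq_div, hns, hnd, lt_div_iff₀ (by linarith)]
  nlinarith

/-- If `u` is a `2`-adic unit, the double of a point whose abscissa is `2`-adically small is not
`2`-adically integral. -/
theorem OnCurve.exists_double_of_lt_one {u x d : ℚ} (hu : padicNorm 2 u = 1) (h : OnCurve u x d)
    (hx : padicNorm 2 x < 1) : ∃ x' d', OnCurve u x' d' ∧ 1 < padicNorm 2 x' := by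
  have hu' : u ∈ twoIntegral := hu.le
  have hb : padicNorm 2 (u * (u + 2) * (2 * u + 1)) = 1 := by
    rw [padicNorm.mul, padicNorm.mul, padicNorm_two_mul_add_one hu', add_comm,
      padicNorm_add_eq_right] <;> rw [hu]
    · norm_num
    · rw [padicNorm_two_two]; norm_num
  have hpos : 0 < padicNorm 2 x :=
    lt_of_le_of_ne (padicNorm.nonneg _) (padicNorm.nonzero h.1).symm
  have hxx : padicNorm 2 (x ^ 2) = padicNorm 2 x ^ 2 := by rw [pow_two, padicNorm.mul, pow_two]
  obtain ⟨s, hs⟩ : ∃ s, x * s = x ^ 2 - u * (u + 2) * (2 * u + 1) :=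
    ⟨(x ^ 2 - u * (u + 2) * (2 * u + 1)) / x, mul_div_cancel₀ _ h.1⟩
  have hns : padicNorm 2 x * padicNorm 2 s = 1 := by
    have := congrArg (padicNorm 2) hs
    rwa [sub_eq_add_neg, padicNorm_add_eq_right, padicNorm.mul, padicNorm.neg, hb] at this
    rw [padicNorm.neg, hxx, hb]; nlinarith
  have hnd : padicNorm 2 x * padicNorm 2 d ^ 2 = 1 := by
    have := congrArg (padicNorm 2) h.2
    rwa [padicNorm_add_eq_right, padicNorm.mul, pow_two d, padicNorm.mul, hb, ← pow_two] at this
    rw [hb, show x ^ 2 - 2 * u * x = x * x + 2 * (-u) * x by ring]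
    have := padicNorm_two_mul_lt_one (twoIntegral.neg_mem hu')
    have := padicNorm.nonneg (p := 2) (2 * -u)
    refine padicNorm.nonarchimedean.trans_lt (max_lt ?_ ?_) <;> rw [padicNorm.mul] <;> nlinarith
  have hs0 : s ≠ 0 := by
    rintro rfl
    simp at hns
  have hd0 : d ≠ 0 := by
    rintro rfl
    simp at hnd
  refine ⟨_, _, h.double hs hs0 hd0, ?_⟩
  rw [padicNorm_sq_div, eq_div_of_mul_eq hpos.ne' ((mul_comm _ _).trans hns),
    eq_div_of_mul_eq hpos.ne' ((mul_comm _ _).trans hnd)]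
  field_simp
  linarith

theorem onCurve_base {u : ℚ} (h : u ≠ 1) :
    OnCurve u (((u - 1) / 2) ^ 2) ((u ^ 2 + 10 * u + 1) / (2 * (u - 1))) := by
  have h' : u - 1 ≠ 0 := sub_ne_zero.2 h
  refine ⟨by positivity, ?_⟩
  field_simp
  ring

/-- A point that is not `2`-adically integral exists when `u` is `2`-adically integral. -/
theorem exists_onCurve_one_lt {u : ℚ} (hu : u ∈ twoIntegral) (h1 : u ≠ 1) (h2 : u ≠ -1) :
    ∃ x d, OnCurve u x d ∧ 1 < padicNorm 2 x := by
  rcases lt_or_eq_of_le (show padicNorm 2 u ≤ 1 from hu) with hlt | hunit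
  · refine ⟨_, _, onCurve_base h1, ?_⟩
    have : padicNorm 2 (u - 1) = 1 := by
      rw [sub_eq_add_neg, padicNorm_add_eq_right] <;> simp [hlt]
    rw [pow_two, padicNorm.mul, padicNorm.div, this, padicNorm_two_two]
    norm_num
  obtain ⟨m, hm, rfl⟩ := exists_eq_two_mul_add_one hunit
  have hbase := onCurve_base h1
  have hx : (2 * m + 1 - 1) / 2 = m := by ring
  rw [hx] at hbase
  rcases lt_or_eq_of_le (show padicNorm 2 m ≤ 1 from hm) with hlt | hmunit
  · refine hbase.exists_double_of_lt_one hunit ?_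
    have := padicNorm.nonneg (p := 2) m
    rw [pow_two, padicNorm.mul]
    nlinarith
  obtain ⟨k, hk, rfl⟩ := exists_eq_two_mul_add_one hmunit
  let l : twoIntegral := ⟨k, hk⟩
  have hk1 : 1 + k ≠ 0 := fun h => h2 (by linarith)
  have hm0 : 2 * k + 1 ≠ 0 := fun h => h1 (by linarith)
  have hA : padicNorm 2 (2 * (k ^ 2 + 4 * k + 2) + 1) = 1 :=
    padicNorm_two_mul_add_one (l ^ 2 + 4 * l + 2).2
  have hB : padicNorm 2 (2 * (k ^ 2 - 8 * k - 7) + 1) = 1 :=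
    padicNorm_two_mul_add_one (l ^ 2 - 8 * l - 7).2
  have hk1' : padicNorm 2 (1 + k) ≤ 1 := (1 + l).2
  have hne : ∀ {q : ℚ}, padicNorm 2 q = 1 → q ≠ 0 := by
    rintro q hq rfl
    simp at hq
  set d := ((2 * (2 * k + 1) + 1) ^ 2 + 10 * (2 * (2 * k + 1) + 1) + 1) /
    (2 * (2 * (2 * k + 1) + 1 - 1)) with hd
  have hd' : d = 2 * (2 * (k ^ 2 + 4 * k + 2) + 1) / (2 * k + 1) := by
    rw [hd]
    field_simp
    ring
  have hnd : padicNorm 2 d = 1 / 2 := by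
    rw [hd', padicNorm.div, padicNorm.mul, hA, hmunit, padicNorm_two_two]
    norm_num
  set s := 8 * (1 + k) ^ 2 * (2 * (k ^ 2 - 8 * k - 7) + 1) / (2 * k + 1) ^ 2 with hs
  have hs0 : s ≠ 0 := by
    have := hne hB
    positivity
  have hns : padicNorm 2 s ≤ 1 / 8 := by
    have hs' : s = 2 * (2 * (2 * ((1 + k) * (1 + k) * (2 * (k ^ 2 - 8 * k - 7) + 1)))) /
        ((2 * k + 1) * (2 * k + 1)) := by
      rw [hs]
      ring
    rw [hs', padicNorm.div, padicNorm.mul 2, padicNorm.mul 2, padicNorm.mul 2,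
      padicNorm.mul (_ * _), hB, padicNorm.mul (1 + k), padicNorm.mul (2 * k + 1), hmunit,
      padicNorm_two_two]
    have := padicNorm.nonneg (p := 2) (1 + k)
    nlinarith
  have hd0 : d ≠ 0 := by
    intro h
    rw [h, padicNorm.zero] at hnd
    norm_num at hnd
  refine (hbase.double (s := s) ?_ hs0 hd0).exists_double_of_lt_one hunit ?_
  · rw [hs]
    field_simp
    ring
  · rw [padicNorm_sq_div, hnd, div_lt_one (by norm_num)]
    have := padicNorm.nonneg (p := 2) s
    nlinarith

/-- The point of the quartic surface attached to the point `(x, d * x)` of the elliptic curve. -/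
def surfacePoint (u x d : ℚ) : ℚ × ℚ × ℚ × ℚ :=
  let e := d - 1 - u
  let n := u + d - x
  let X := -(n ^ 2 + 2 * u * e ^ 2)
  (X, 2 * e * (n - e), X + 2 * (n - e) * n, X + 2 * (n - e) * (n + d * e))

theorem surfacePoint_mem {u x d : ℚ} (h : OnCurve u x d) :
    (1 + u) * (surfacePoint u x d).1 ^ 4 + 4 * u ^ 2 * (1 + u) * (surfacePoint u x d).2.1 ^ 4 -
      u * (surfacePoint u x d).2.2.1 ^ 4 - (surfacePoint u x d).2.2.2 ^ 4 = 0 := by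
  obtain ⟨hx, h⟩ := h
  set X := (surfacePoint u x d).1 with hX
  set Y := (surfacePoint u x d).2.1 with hY
  set Z := (surfacePoint u x d).2.2.1 with hZ
  set W := (surfacePoint u x d).2.2.2 with hW
  simp only [surfacePoint] at hX hY hZ hW
  have hZ2 : Z ^ 2 = X ^ 2 + 2 * X * Y - 2 * u * Y ^ 2 := by
    rw [hZ, hX, hY]
    ring
  have hW2 : W ^ 2 = X ^ 2 - 2 * u * X * Y - 2 * u * Y ^ 2 := by
    rw [hW, hX, hY]
    linear_combination -4 * (u + d - x - (d - 1 - u)) * (d - 1 - u) ^ 2 * h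
  linear_combination (-u) * (Z ^ 2 + (X ^ 2 + 2 * X * Y - 2 * u * Y ^ 2)) * hZ2 -
    (W ^ 2 + (X ^ 2 - 2 * u * X * Y - 2 * u * Y ^ 2)) * hW2

theorem surfacePoint_snd_ne_zero {u x d : ℚ} (hu : u ∈ twoIntegral) (h : OnCurve u x d)
    (hx : 1 < padicNorm 2 x) : (surfacePoint u x d).2.1 ≠ 0 := by
  let v : twoIntegral := ⟨u, hu⟩
  have hlin : x ∉ twoIntegral := fun hmem => not_le.2 hx hmem
  simp only [surfacePoint]
  refine mul_ne_zero (mul_ne_zero two_ne_zero fun he => ?_) fun hne => ?_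
  · have hd : d = 1 + u := by linarith
    have hq := h.2
    rw [hd] at hq
    have : (x - u * (u + 2)) * (x - (2 * u + 1)) = 0 := by linear_combination -hq
    rcases mul_eq_zero.1 this with h0 | h0
    · exact hlin (sub_eq_zero.1 h0 ▸ (v * (v + 2)).2)
    · exact hlin (sub_eq_zero.1 h0 ▸ (2 * v + 1).2)
  · exact hlin ((show x = 2 * u + 1 by linarith) ▸ (2 * v + 1).2)

theorem eq_of_surfacePoint_proportional {u x d x' d' c : ℚ} (hc : c ≠ 0)
    (hY' : (surfacePoint u x' d').2.1 ≠ 0)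
    (h1 : (surfacePoint u x d).1 = c * (surfacePoint u x' d').1)
    (h2 : (surfacePoint u x d).2.1 = c * (surfacePoint u x' d').2.1)
    (h3 : (surfacePoint u x d).2.2.1 = c * (surfacePoint u x' d').2.2.1)
    (h4 : (surfacePoint u x d).2.2.2 = c * (surfacePoint u x' d').2.2.2) :
    x = x' ∧ d = d' := by
  have hd : ∀ y e : ℚ, (surfacePoint u y e).2.2.2 - (surfacePoint u y e).2.2.1
      = e * (surfacePoint u y e).2.1 := by
    intro y e
    simp only [surfacePoint]
    ring
  have hx : ∀ y e : ℚ, (e - 1 - u) *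
      ((surfacePoint u y e).2.2.1 - (surfacePoint u y e).1)
      = (u + e - y) * (surfacePoint u y e).2.1 := by
    intro y e
    simp only [surfacePoint]
    ring
  have hcY := mul_ne_zero hc hY'
  have hdd : d = d' := by
    apply mul_right_cancel₀ hcY
    linear_combination -(hd x d) + c * hd x' d' + h4 - h3 - d * h2
  subst hdd
  refine ⟨mul_right_cancel₀ hcY ?_, rfl⟩
  linear_combination hx x d - c * hx x' d - (d - 1 - u) * (h3 - h1) + (u + d - x) * h2

/-- The quadruples in `S` are pairwise non-proportional. -/
def PairwiseNonproportional (S : Set (ℚ × ℚ × ℚ × ℚ)) : Prop :=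
  ∀ P ∈ S, ∀ Q ∈ S, P ≠ Q →
    ¬ ∃ c : ℚ, c ≠ 0 ∧ P.1 = c * Q.1 ∧ P.2.1 = c * Q.2.1 ∧
      P.2.2.1 = c * Q.2.2.1 ∧ P.2.2.2 = c * Q.2.2.2

/-- `P` is a nonzero quadruple on the quartic surface with parameter `u`. -/
def OnSurface (u : ℚ) (P : ℚ × ℚ × ℚ × ℚ) : Prop :=
  P ≠ (0, 0, 0, 0) ∧
    (1 + u) * P.1 ^ 4 + 4 * u ^ 2 * (1 + u) * P.2.1 ^ 4 - u * P.2.2.1 ^ 4 - P.2.2.2 ^ 4 = 0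

theorem exists_infinite_of_mem_twoIntegral {u : ℚ} (hu : u ∈ twoIntegral) (h1 : u ≠ 1)
    (h2 : u ≠ -1) : ∃ S : Set (ℚ × ℚ × ℚ × ℚ), S.Infinite ∧ (∀ P ∈ S, OnSurface u P) ∧
      PairwiseNonproportional S := by
  set T : Set (ℚ × ℚ) := {p | OnCurve u p.1 p.2 ∧ 1 < padicNorm 2 p.1} with hT
  have hTinf : T.Infinite := by
    obtain ⟨x, d, h, hx⟩ := exists_onCurve_one_lt hu h1 h2
    refine Set.Infinite.of_image (fun p : ℚ × ℚ => padicNorm 2 p.1) ?_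
    have hne : ((fun p : ℚ × ℚ => padicNorm 2 p.1) '' T).Nonempty := ⟨_, (x, d), ⟨h, hx⟩, rfl⟩
    intro hfin
    obtain ⟨_, ⟨p, hp, rfl⟩, hmax⟩ := hfin.exists_maximal hne
    obtain ⟨x', d', h', hlt⟩ := hp.1.exists_double_of_one_lt hu hp.2
    exact not_le.2 hlt (hmax ⟨(x', d'), ⟨h', hp.2.trans hlt⟩, rfl⟩ hlt.le)
  have hprop : ∀ p ∈ T, ∀ q ∈ T, ∀ c : ℚ, c ≠ 0 →
      (surfacePoint u p.1 p.2).1 = c * (surfacePoint u q.1 q.2).1 →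
      (surfacePoint u p.1 p.2).2.1 = c * (surfacePoint u q.1 q.2).2.1 →
      (surfacePoint u p.1 p.2).2.2.1 = c * (surfacePoint u q.1 q.2).2.2.1 →
      (surfacePoint u p.1 p.2).2.2.2 = c * (surfacePoint u q.1 q.2).2.2.2 → p = q := by
    intro p _ q hq c hc e1 e2 e3 e4
    exact Prod.ext_iff.2 (eq_of_surfacePoint_proportional hc
      (surfacePoint_snd_ne_zero hu hq.1 hq.2) e1 e2 e3 e4)
  refine ⟨(fun p : ℚ × ℚ => surfacePoint u p.1 p.2) '' T, hTinf.image ?_, ?_, ?_⟩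
  · intro p hp q hq (h : surfacePoint u p.1 p.2 = surfacePoint u q.1 q.2)
    exact hprop p hp q hq 1 one_ne_zero (by simp [h]) (by simp [h]) (by simp [h]) (by simp [h])
  · rintro _ ⟨p, hp, rfl⟩
    refine ⟨fun h => surfacePoint_snd_ne_zero hu hp.1 hp.2 ?_, surfacePoint_mem hp.1⟩
    exact congrArg (fun P => P.2.1) h
  · rintro _ ⟨p, hp, rfl⟩ _ ⟨q, hq, rfl⟩ hne ⟨c, hc, e1, e2, e3, e4⟩
    exact hne (by rw [hprop p hp q hq c hc e1 e2 e3 e4])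

/-- The surfaces with parameters `u` and `u⁻¹` are isomorphic. -/
theorem exists_infinite_of_inv {u : ℚ} (hu : u ≠ 0)
    (h : ∃ S : Set (ℚ × ℚ × ℚ × ℚ), S.Infinite ∧ (∀ P ∈ S, OnSurface u⁻¹ P) ∧
      PairwiseNonproportional S) :
    ∃ S : Set (ℚ × ℚ × ℚ × ℚ), S.Infinite ∧ (∀ P ∈ S, OnSurface u P) ∧
      PairwiseNonproportional S := by
  obtain ⟨S, hinf, hS, hprop⟩ := h
  refine ⟨(fun P : ℚ × ℚ × ℚ × ℚ => (P.1, u⁻¹ * P.2.1, P.2.2.2, P.2.2.1)) '' S,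
    hinf.image ?_, ?_, ?_⟩
  · rintro ⟨a, b, c, d⟩ _ ⟨a', b', c', d'⟩ _ h
    simp only [Prod.mk.injEq] at h ⊢
    exact ⟨h.1, mul_left_cancel₀ (inv_ne_zero hu) h.2.1, h.2.2.2, h.2.2.1⟩
  · rintro _ ⟨⟨a, b, c, d⟩, hP, rfl⟩
    obtain ⟨hne, heq⟩ := hS _ hP
    refine ⟨fun h => hne ?_, ?_⟩
    · simp_all
    · simp only at heq ⊢
      field_simp at heq ⊢
      linear_combination heq
  · rintro _ ⟨P, hP, rfl⟩ _ ⟨Q, hQ, rfl⟩ hne ⟨c, hc, e1, e2, e3, e4⟩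
    refine hprop P hP Q hQ (fun h => hne (by rw [h])) ⟨c, hc, e1, ?_, e4, e3⟩
    apply mul_left_cancel₀ (inv_ne_zero hu)
    linear_combination e2

theorem stmt_4 (u : ℚ) (hu : u ≠ -2 ∧ u ≠ -1 ∧ u ≠ -1/2 ∧ u ≠ 0 ∧ u ≠ 1) :
    ∃ S : Set (ℚ × ℚ × ℚ × ℚ), S.Infinite ∧
      (∀ P ∈ S, P ≠ (0, 0, 0, 0) ∧
        (1 + u) * P.1 ^ 4 + 4 * u ^ 2 * (1 + u) * P.2.1 ^ 4 - u * P.2.2.1 ^ 4 -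
          P.2.2.2 ^ 4 = 0) ∧
      ∀ P ∈ S, ∀ Q ∈ S, P ≠ Q →
        ¬ ∃ c : ℚ, c ≠ 0 ∧ P.1 = c * Q.1 ∧ P.2.1 = c * Q.2.1 ∧
          P.2.2.1 = c * Q.2.2.1 ∧ P.2.2.2 = c * Q.2.2.2 := by
  obtain ⟨-, h2, -, h0, h1⟩ := hu
  rcases le_total (padicNorm 2 u) 1 with h | h
  · exact exists_infinite_of_mem_twoIntegral h h1 h2
  · refine exists_infinite_of_inv h0 (exists_infinite_of_mem_twoIntegral ?_ (by simpa using h1) ?_)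
    · change padicNorm 2 u⁻¹ ≤ 1
      rw [← one_div, padicNorm.div, padicNorm.one]
      exact div_le_one_of_le₀ h (padicNorm.nonneg _)
    · intro h'
      apply h2
      rw [← inv_inv u, h']
      norm_num
end

section
/- For every nonzero rational number u, the diagonal quartic surface X⁴ + Y⁴ − 2Z⁴ − 2(1 + 6u²)W⁴ = 0 has infinitely many rational points; that is, there exist infinitely many pairwise non-proportional quadruples (X, Y, Z, W) ∈ ℚ⁴ \ {(0,0,0,0)} satisfying the equation. -/
/-- The denominator of tripling on `6 z ^ 2 + 1 = c * w ^ 4`, in the coordinate `t = c * w ^ 4`. -/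
def tripleDen (t : ℚ) : ℚ := 1 + 6 * t - 3 * t ^ 2

/-- The factor by which tripling on `6 z ^ 2 + 1 = c * w ^ 4` scales `w`, up to `tripleDen`. -/
def tripleNumW (t : ℚ) : ℚ := 3 - 6 * t - t ^ 2

/-- The factor by which tripling on `6 z ^ 2 + 1 = c * w ^ 4` scales `z`, up to `tripleDen ^ 2`. -/
def tripleNumZ (t : ℚ) : ℚ := 1 - 28 * t + 6 * t ^ 2 - 28 * t ^ 3 + t ^ 4

theorem triple_identity (t : ℚ) :
    (t - 1) * tripleNumZ t ^ 2 + tripleDen t ^ 4 = t * tripleNumW t ^ 4 := by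
  unfold tripleNumZ tripleDen tripleNumW
  ring

theorem triple_mem_curve {c z w : ℚ} (h : 6 * z ^ 2 + 1 = c * w ^ 4)
    (hD : tripleDen (6 * z ^ 2 + 1) ≠ 0) :
    6 * (z * (tripleNumZ (6 * z ^ 2 + 1) / tripleDen (6 * z ^ 2 + 1) ^ 2)) ^ 2 + 1 =
      c * (w * (tripleNumW (6 * z ^ 2 + 1) / tripleDen (6 * z ^ 2 + 1))) ^ 4 := by
  have key := triple_identity (6 * z ^ 2 + 1)
  generalize tripleNumZ (6 * z ^ 2 + 1) = N at *
  generalize tripleDen (6 * z ^ 2 + 1) = D at *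
  generalize tripleNumW (6 * z ^ 2 + 1) = K at *
  field_simp
  linear_combination key + K ^ 4 * h

theorem Int.not_three_dvd_of_eq_pow_add {a m k : ℤ} {n : ℕ} (ha : ¬ 3 ∣ a)
    (h : m = a ^ n + 3 * k) : ¬ 3 ∣ m := by
  rintro ⟨l, rfl⟩
  exact ha (Int.prime_three.dvd_of_dvd_pow (n := n) ⟨l - k, by linarith⟩)

theorem Int.cast_rat_ne_zero_of_not_three_dvd {m : ℤ} (h : ¬ 3 ∣ m) : (m : ℚ) ≠ 0 := by
  rintro h0
  exact h (by simp [Int.cast_eq_zero.1 h0])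

theorem padicValRat_three_intCast {m : ℤ} (h : ¬ 3 ∣ m) : padicValRat 3 (m : ℚ) = 0 := by
  rw [padicValRat.of_int, padicValInt.eq_zero_of_not_dvd (by exact_mod_cast h)]
  rfl

theorem padicValRat_three_div_sq {m k : ℤ} (hm : ¬ 3 ∣ m) (hk : ¬ 3 ∣ k) :
    padicValRat 3 ((m : ℚ) / k ^ 2) = 0 := by
  have hm0 : (m : ℚ) ≠ 0 := Int.cast_rat_ne_zero_of_not_three_dvd hm
  have hk0 : (k : ℚ) ≠ 0 := Int.cast_rat_ne_zero_of_not_three_dvd hk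
  rw [padicValRat.div hm0 (pow_ne_zero 2 hk0), padicValRat.pow,
    padicValRat_three_intCast hm, padicValRat_three_intCast hk]
  simp

theorem exists_triple_ratio_of_not_dvd_den {a b : ℤ} (hb : ¬ 3 ∣ b) :
    tripleDen (6 * ((a : ℚ) / b) ^ 2 + 1) ≠ 0 ∧ ∃ m k : ℤ, ¬ 3 ∣ m ∧ ¬ 3 ∣ k ∧
      tripleNumZ (6 * ((a : ℚ) / b) ^ 2 + 1) / tripleDen (6 * ((a : ℚ) / b) ^ 2 + 1) ^ 2 =
        3 * ((m : ℚ) / k ^ 2) := by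
  have hb0 : (b : ℚ) ≠ 0 := Int.cast_rat_ne_zero_of_not_three_dvd hb
  obtain ⟨k, hk⟩ : ∃ k, k = b ^ 4 + 3 * (2 * b ^ 2 * (b ^ 2 + 6 * a ^ 2)
    - (b ^ 2 + 6 * a ^ 2) ^ 2) := ⟨_, rfl⟩
  obtain ⟨m, hm⟩ : ∃ m, m = -16 * b ^ 8 - 192 * a ^ 2 * b ^ 6 - 864 * a ^ 4 * b ^ 4
    - 1728 * a ^ 6 * b ^ 2 + 432 * a ^ 8 := ⟨_, rfl⟩
  have hk3 : ¬ 3 ∣ k := Int.not_three_dvd_of_eq_pow_add hb hk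
  have hm3 : ¬ 3 ∣ -m := Int.not_three_dvd_of_eq_pow_add (n := 8)
    (k := 5 * b ^ 8 + 64 * a ^ 2 * b ^ 6 + 288 * a ^ 4 * b ^ 4 + 576 * a ^ 6 * b ^ 2
      - 144 * a ^ 8) hb (by rw [hm]; ring)
  have hk0 : (k : ℚ) ≠ 0 := Int.cast_rat_ne_zero_of_not_three_dvd hk3
  have hD : tripleDen (6 * ((a : ℚ) / b) ^ 2 + 1) = k / b ^ 4 := by
    rw [hk, tripleDen]; push_cast; field_simp; ring
  have hN : tripleNumZ (6 * ((a : ℚ) / b) ^ 2 + 1) = 3 * m / b ^ 8 := by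
    rw [hm, tripleNumZ]; push_cast; field_simp; ring
  refine ⟨by rw [hD]; positivity, m, k, fun h => hm3 (dvd_neg.2 h), hk3, ?_⟩
  rw [hD, hN]
  field_simp

theorem exists_triple_ratio_of_dvd_den {a b : ℤ} (hb : b ≠ 0) (ha : ¬ 3 ∣ a) :
    tripleDen (6 * ((a : ℚ) / (3 * b : ℤ)) ^ 2 + 1) ≠ 0 ∧ ∃ m k : ℤ, ¬ 3 ∣ m ∧ ¬ 3 ∣ k ∧
      tripleNumZ (6 * ((a : ℚ) / (3 * b : ℤ)) ^ 2 + 1) /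
        tripleDen (6 * ((a : ℚ) / (3 * b : ℤ)) ^ 2 + 1) ^ 2 = ((m : ℚ) / k ^ 2) / 3 ^ 2 := by
  have hb0 : (b : ℚ) ≠ 0 := by exact_mod_cast hb
  obtain ⟨e, he⟩ : ∃ e, e = 3 * b ^ 2 + 2 * a ^ 2 := ⟨_, rfl⟩
  have he3 : ¬ 3 ∣ -e := Int.not_three_dvd_of_eq_pow_add (n := 2) (k := -b ^ 2 - a ^ 2) ha
    (by rw [he]; ring)
  obtain ⟨k, hk⟩ : ∃ k, k = 3 * b ^ 4 + 6 * b ^ 2 * e - e ^ 2 := ⟨_, rfl⟩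
  obtain ⟨m, hm⟩ : ∃ m, m = 81 * b ^ 8 - 756 * b ^ 6 * e + 54 * b ^ 4 * e ^ 2
    - 84 * b ^ 2 * e ^ 3 + e ^ 4 := ⟨_, rfl⟩
  have hk3 : ¬ 3 ∣ -k := Int.not_three_dvd_of_eq_pow_add (n := 2)
    (k := -b ^ 4 - 2 * b ^ 2 * e) he3 (by rw [hk]; ring)
  have hm3 : ¬ 3 ∣ m := Int.not_three_dvd_of_eq_pow_add (n := 4)
    (k := 27 * b ^ 8 - 252 * b ^ 6 * e + 18 * b ^ 4 * e ^ 2 - 28 * b ^ 2 * e ^ 3) he3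
    (by rw [hm]; ring)
  have hk0 : (k : ℚ) ≠ 0 := Int.cast_rat_ne_zero_of_not_three_dvd fun h => hk3 (dvd_neg.2 h)
  have ht : 6 * ((a : ℚ) / (3 * b : ℤ)) ^ 2 + 1 = e / (3 * b ^ 2) := by
    rw [he]; push_cast; field_simp; ring
  have hD : tripleDen ((e : ℚ) / (3 * b ^ 2)) = k / (3 * b ^ 4) := by
    rw [hk, tripleDen]; push_cast; field_simp
  have hN : tripleNumZ ((e : ℚ) / (3 * b ^ 2)) = m / (81 * b ^ 8) := by
    rw [hm, tripleNumZ]; push_cast; field_simp; ring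
  rw [ht, hD, hN]
  refine ⟨by positivity, m, k, hm3, fun h => hk3 (dvd_neg.2 h), ?_⟩
  field_simp
  norm_num

theorem padicValRat_three_triple {z : ℚ} (hz : z ≠ 0) :
    tripleDen (6 * z ^ 2 + 1) ≠ 0 ∧
      z * (tripleNumZ (6 * z ^ 2 + 1) / tripleDen (6 * z ^ 2 + 1) ^ 2) ≠ 0 ∧
      (padicValRat 3 z).natAbs < (padicValRat 3
        (z * (tripleNumZ (6 * z ^ 2 + 1) / tripleDen (6 * z ^ 2 + 1) ^ 2))).natAbs := by
  have h33 : padicValRat 3 (3 : ℚ) = 1 := by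
    exact_mod_cast padicValRat.self (p := 3) (by norm_num)
  have hnum : (z.num : ℚ) ≠ 0 := by exact_mod_cast Rat.num_ne_zero.2 hz
  have hden : ((z.den : ℤ) : ℚ) ≠ 0 := by exact_mod_cast z.den_ne_zero
  have hzdiv : (z.num : ℚ) / (z.den : ℤ) = z := by exact_mod_cast z.num_div_den
  have hval : padicValRat 3 z = padicValInt 3 z.num - padicValInt 3 z.den := by
    conv_lhs => rw [← hzdiv]
    rw [padicValRat.div hnum hden, padicValRat.of_int, padicValRat.of_int]
  by_cases hb : (3 : ℤ) ∣ z.den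
  · have ha : ¬ (3 : ℤ) ∣ z.num := fun h => by
      have h1 := Nat.dvd_gcd (Int.natAbs_dvd_natAbs.2 h) (Int.natAbs_dvd_natAbs.2 hb)
      rw [Int.natAbs_natCast, z.reduced.gcd_eq_one] at h1
      norm_num at h1
    obtain ⟨b, hbeq⟩ := hb
    have hb0 : b ≠ 0 := by rintro rfl; simp [hbeq] at hden
    obtain ⟨hD, m, k, hm, hk, hr⟩ := exists_triple_ratio_of_dvd_den hb0 ha
    rw [← hbeq, hzdiv] at hD hr
    have hq : (m : ℚ) / k ^ 2 ≠ 0 :=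
      div_ne_zero (Int.cast_rat_ne_zero_of_not_three_dvd hm)
        (pow_ne_zero 2 (Int.cast_rat_ne_zero_of_not_three_dvd hk))
    have hr0 : (m : ℚ) / k ^ 2 / 3 ^ 2 ≠ 0 := div_ne_zero hq (by norm_num)
    refine ⟨hD, ?_⟩
    rw [hr]
    refine ⟨mul_ne_zero hz hr0, ?_⟩
    rw [padicValRat.mul hz hr0, padicValRat.div hq (by norm_num), padicValRat.pow,
      padicValRat_three_div_sq hm hk, h33, hval,
      padicValInt.eq_zero_of_not_dvd (by exact_mod_cast ha)]
    omega
  · obtain ⟨hD, m, k, hm, hk, hr⟩ := exists_triple_ratio_of_not_dvd_den (a := z.num) hb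
    rw [hzdiv] at hD hr
    have hq : (m : ℚ) / k ^ 2 ≠ 0 :=
      div_ne_zero (Int.cast_rat_ne_zero_of_not_three_dvd hm)
        (pow_ne_zero 2 (Int.cast_rat_ne_zero_of_not_three_dvd hk))
    have hr0 : 3 * ((m : ℚ) / k ^ 2) ≠ 0 := mul_ne_zero (by norm_num) hq
    refine ⟨hD, ?_⟩
    rw [hr]
    refine ⟨mul_ne_zero hz hr0, ?_⟩
    rw [padicValRat.mul hz hr0, padicValRat.mul (by norm_num) hq,
      padicValRat_three_div_sq hm hk, h33, hval,
      padicValInt.eq_zero_of_not_dvd (z := z.den) (by exact_mod_cast hb)]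
    omega

theorem infinite_curve_points {c z₀ w₀ : ℚ} (hz₀ : z₀ ≠ 0) (h₀ : 6 * z₀ ^ 2 + 1 = c * w₀ ^ 4) :
    {z : ℚ | ∃ w, 6 * z ^ 2 + 1 = c * w ^ 4}.Infinite := by
  let T : Set ℚ := {z | z ≠ 0 ∧ ∃ w, 6 * z ^ 2 + 1 = c * w ^ 4}
  have hT : T.Infinite := by
    intro hfin
    obtain ⟨z, ⟨hz, w, hw⟩, hmax⟩ := Set.exists_max_image T
      (fun z => (padicValRat 3 z).natAbs) hfin ⟨z₀, hz₀, w₀, h₀⟩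
    obtain ⟨hD, hne, hlt⟩ := padicValRat_three_triple hz
    exact (hmax _ ⟨hne, _, triple_mem_curve hw hD⟩).not_gt hlt
  exact hT.mono fun z hz => hz.2


theorem stmt_8 (u : ℚ) (hu : u ≠ 0) :
    ∃ S : Set (ℚ × ℚ × ℚ × ℚ), S.Infinite ∧
      (∀ P ∈ S, P ≠ (0, 0, 0, 0) ∧
        P.1 ^ 4 + P.2.1 ^ 4 - 2 * P.2.2.1 ^ 4 -
          2 * (1 + 6 * u ^ 2) * P.2.2.2 ^ 4 = 0) ∧
      ∀ P ∈ S, ∀ Q ∈ S, P ≠ Q →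
        ¬ ∃ c : ℚ, c ≠ 0 ∧ P.1 = c * Q.1 ∧ P.2.1 = c * Q.2.1 ∧
          P.2.2.1 = c * Q.2.2.1 ∧ P.2.2.2 = c * Q.2.2.2 := by
  refine ⟨{P | ∃ z w : ℚ, 6 * z ^ 2 + 1 = (1 + 6 * u ^ 2) * w ^ 4 ∧ P = (z + 1, z - 1, z, w)},
    ?_, ?_, ?_⟩
  · refine Set.Infinite.of_image (fun P => P.2.2.1) ?_
    refine (infinite_curve_points (c := 1 + 6 * u ^ 2) (w₀ := 1) hu (by ring)).mono ?_
    rintro z ⟨w, hw⟩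
    exact ⟨_, ⟨z, w, hw, rfl⟩, rfl⟩
  · rintro _ ⟨z, w, hw, rfl⟩
    constructor
    · intro h
      simp only [Prod.mk.injEq] at h
      linarith [h.1, h.2.2.1]
    · linear_combination 2 * hw
  · rintro _ ⟨z, w, -, rfl⟩ _ ⟨z', w', -, rfl⟩ hne ⟨c, -, h1, h2, h3, h4⟩
    dsimp only at h1 h2 h3 h4
    obtain rfl : c = 1 := by linarith
    rw [one_mul] at h3 h4
    exact hne (by rw [h3, h4])
end

section
/- For every nonzero integer m, there exist nonzero integers a, b, c, d and a nonzero rational number s with a·b·c·d = m·s² (i.e., abcd ≡ m modulo rational squares), such that the diagonal quartic surface ax⁴ + by⁴ + cz⁴ + dw⁴ = 0 has infinitely many rational points, i.e., infinitely many pairwise non-proportional quadruples (x, y, z, w) ∈ ℚ⁴ \ {(0,0,0,0)} satisfying the equation. -/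
/-- The duplication formula on the cubic curve `D * y ^ 2 = x ^ 3 + 2 * m * x`. -/
theorem cubic_duplication {K : Type*} [Field K] [CharZero K] {D m x y : K} (hD : D ≠ 0)
    (hy : y ≠ 0) (h : D * y ^ 2 = x ^ 3 + 2 * m * x) :
    D * ((x ^ 2 - 2 * m) * (x ^ 4 + 12 * m * x ^ 2 + 4 * m ^ 2) / (8 * D ^ 2 * y ^ 3)) ^ 2 =
      ((x ^ 2 - 2 * m) ^ 2 / (4 * (D * y ^ 2))) ^ 3 +
        2 * m * ((x ^ 2 - 2 * m) ^ 2 / (4 * (D * y ^ 2))) := by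
  have key : (x ^ 4 + 12 * m * x ^ 2 + 4 * m ^ 2) ^ 2 =
      (x ^ 2 - 2 * m) ^ 4 + 32 * m * (D * y ^ 2) ^ 2 := by
    rw [h]; ring
  calc
    _ = (x ^ 2 - 2 * m) ^ 2 * (x ^ 4 + 12 * m * x ^ 2 + 4 * m ^ 2) ^ 2 /
        (64 * D ^ 3 * y ^ 6) := by field_simp; ring
    _ = _ := by rw [key]; field_simp; ring

theorem Odd.intCast_rat_ne_zero {t : ℤ} (ht : Odd t) : (t : ℚ) ≠ 0 := by
  have : t ≠ 0 := by rintro rfl; simp at ht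
  exact_mod_cast this

/-- Repeated duplication of the point `(1, 1)` produces abscissas with denominators divisible by
arbitrarily large powers of `4`. -/
theorem exists_cubic_point_odd_div (m : ℤ) (n : ℕ) :
    ∃ (p q : ℤ) (y : ℚ), Odd p ∧ Odd q ∧
      (2 * m + 1 : ℚ) * y ^ 2 =
        ((p : ℚ) / (4 ^ n * q)) ^ 3 + 2 * m * ((p : ℚ) / (4 ^ n * q)) := by
  have hD : (2 * m + 1 : ℚ) ≠ 0 := by
    have : 2 * m + 1 ≠ 0 := by omega
    exact_mod_cast this
  induction n with
  | zero => exact ⟨1, 1, 1, odd_one, odd_one, by norm_num; ring⟩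
  | succ n ih =>
    obtain ⟨p, q, y, hp, hq, h⟩ := ih
    have hodd : ∀ t : ℤ, Odd (p ^ 2 + 2 * t) := fun t => hp.pow.add_even (even_two_mul t)
    have hminus := hodd (-(m * 16 ^ n * q ^ 2))
    have hplus := hodd (m * 16 ^ n * q ^ 2)
    set x : ℚ := (p : ℚ) / (4 ^ n * q) with hx
    refine ⟨(p ^ 2 + 2 * -(m * 16 ^ n * q ^ 2)) ^ 2, q * p * (p ^ 2 + 2 * (m * 16 ^ n * q ^ 2)),
      (x ^ 2 - 2 * m) * (x ^ 4 + 12 * m * x ^ 2 + 4 * m ^ 2) / (8 * (2 * m + 1) ^ 2 * y ^ 3),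
      hminus.pow, (hq.mul hp).mul hplus, ?_⟩
    have hp0 := hp.intCast_rat_ne_zero
    have hq0 := hq.intCast_rat_ne_zero
    have hplus0 := hplus.intCast_rat_ne_zero
    have h16 : (16 : ℚ) ^ n = (4 ^ n) ^ 2 := by rw [← pow_mul, mul_comm, pow_mul]; norm_num
    push_cast at hplus0 ⊢
    rw [h16] at hplus0 ⊢
    have h4 : (4 : ℚ) ^ n ≠ 0 := by positivity
    rw [pow_succ (4 : ℚ)]
    generalize (4 : ℚ) ^ n = F at *
    have hcubic : x ^ 3 + 2 * m * x =
        p * (p ^ 2 + 2 * (m * F ^ 2 * q ^ 2)) / (F * q) ^ 3 := by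
      rw [hx]; field_simp
    have hsq : x ^ 2 - 2 * m = (p ^ 2 + 2 * -(m * F ^ 2 * q ^ 2)) / (F * q) ^ 2 := by
      rw [hx]; field_simp; ring
    have hy : y ≠ 0 := by
      rintro rfl
      have hne : (p : ℚ) * (p ^ 2 + 2 * (m * F ^ 2 * q ^ 2)) / (F * q) ^ 3 ≠ 0 := by positivity
      rw [← hcubic, ← h] at hne
      simp at hne
    have hx' : (x ^ 2 - 2 * m) ^ 2 / (4 * ((2 * m + 1) * y ^ 2)) =
        ((p : ℚ) ^ 2 + 2 * -(m * F ^ 2 * q ^ 2)) ^ 2 /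
          (F * 4 * (q * p * (p ^ 2 + 2 * (m * F ^ 2 * q ^ 2)))) := by
      rw [h, hcubic, hsq]
      field_simp
    rw [← hx']
    exact cubic_duplication hD hy h

/-- Fractions with odd numerators and distinct powers of `4` in the denominator are distinct. -/
theorem exponent_le_of_odd_div_eq {p q p' q' : ℤ} {n k : ℕ} (hq : Odd q) (hp' : Odd p')
    (hq' : Odd q') (h : (p : ℚ) / (4 ^ n * q) = p' / (4 ^ k * q')) : k ≤ n := by
  by_contra! hlt
  obtain ⟨j, rfl⟩ := Nat.exists_eq_add_of_lt hlt
  have hq0 : (q : ℚ) ≠ 0 := hq.intCast_rat_ne_zero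
  have hq0' : (q' : ℚ) ≠ 0 := hq'.intCast_rat_ne_zero
  have hcross : (p : ℚ) * q' * (4 * 4 ^ j) = p' * q := by
    rw [pow_succ, pow_add] at h
    field_simp at h
    linarith
  have hcross' : p * q' * (4 * 4 ^ j) = p' * q := by exact_mod_cast hcross
  have hodd := hp'.mul hq
  rw [← hcross'] at hodd
  exact absurd (Int.odd_mul.mp (Int.odd_mul.mp hodd).2).1 (by decide)

theorem stmt_14 (m : ℤ) (hm : m ≠ 0) :
    ∃ (a b c d : ℤ) (s : ℚ), a ≠ 0 ∧ b ≠ 0 ∧ c ≠ 0 ∧ d ≠ 0 ∧ s ≠ 0 ∧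
      ((a : ℚ) * b * c * d = m * s ^ 2) ∧
      ∃ S : Set (ℚ × ℚ × ℚ × ℚ), S.Infinite ∧
        (∀ P ∈ S, P ≠ (0, 0, 0, 0) ∧
          (a : ℚ) * P.1 ^ 4 + (b : ℚ) * P.2.1 ^ 4 + (c : ℚ) * P.2.2.1 ^ 4 +
            (d : ℚ) * P.2.2.2 ^ 4 = 0) ∧
        ∀ P ∈ S, ∀ Q ∈ S, P ≠ Q →
          ¬ ∃ e : ℚ, e ≠ 0 ∧ P.1 = e * Q.1 ∧ P.2.1 = e * Q.2.1 ∧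
            P.2.2.1 = e * Q.2.2.1 ∧ P.2.2.2 = e * Q.2.2.2 := by
  have hm' : (m : ℚ) ≠ 0 := by exact_mod_cast hm
  have hD : 2 * m + 1 ≠ 0 := by omega
  have hD' : (2 * m + 1 : ℚ) ≠ 0 := by exact_mod_cast hD
  refine ⟨-1, -(m * (2 * m + 1) ^ 2), 1, 4 * m ^ 2, 2 * m * (2 * m + 1), by norm_num,
    by simp [hm, hD], one_ne_zero, by simp [hm], by simp [hm', hD'], by push_cast; ring, ?_⟩
  choose p q y hp hq h using exists_cubic_point_odd_div m
  let x : ℕ → ℚ := fun n => (p n : ℚ) / (4 ^ n * q n)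
  have hx0 : ∀ n, x n ≠ 0 := fun n =>
    div_ne_zero (hp n).intCast_rat_ne_zero
      (mul_ne_zero (by positivity) (hq n).intCast_rat_ne_zero)
  have hxinj : Function.Injective x := fun n k hnk =>
    le_antisymm (exponent_le_of_odd_div_eq (hq k) (hp n) (hq n) hnk.symm)
      (exponent_le_of_odd_div_eq (hq n) (hp k) (hq k) hnk)
  let f : ℕ → ℚ × ℚ × ℚ × ℚ := fun n =>
    ((x n ^ 2 - 2 * m) / (2 * x n), y n / x n, -(x n ^ 2 + 2 * m) / (2 * x n), 1)
  refine ⟨Set.range f, Set.infinite_range_of_injective fun n k hnk => hxinj ?_, ?_, ?_⟩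
  · have hsub : ∀ n, (f n).1 - (f n).2.2.1 = x n := fun n => by
      have := hx0 n
      simp only [f]
      field_simp
      ring
    rw [← hsub n, ← hsub k, hnk]
  · rintro _ ⟨n, rfl⟩
    refine ⟨by simp [f], ?_⟩
    have hn : (2 * m + 1 : ℚ) * y n ^ 2 = x n ^ 3 + 2 * m * x n := h n
    have hxn := hx0 n
    have hy4 : (2 * m + 1 : ℚ) ^ 2 * (y n / x n) ^ 4 = (x n ^ 2 + 2 * m) ^ 2 / x n ^ 2 := by
      calc
        _ = ((2 * m + 1 : ℚ) * y n ^ 2) ^ 2 / x n ^ 4 := by field_simp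
        _ = _ := by rw [hn]; field_simp
    simp only [f]
    push_cast
    rw [neg_mul (m * (2 * m + 1) ^ 2 : ℚ), mul_assoc (m : ℚ), hy4]
    field_simp
    ring
  · rintro _ ⟨n, rfl⟩ _ ⟨k, rfl⟩ hne ⟨e, -, h1, h2, h3, h4⟩
    have he : e = 1 := by simpa [f] using h4.symm
    subst he
    rw [one_mul] at h1 h2 h3 h4
    exact hne (Prod.ext h1 (Prod.ext h2 (Prod.ext h3 h4)))
end
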